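/- In the setup, the following two identities hold in F: (a) ∑_{γ ∈ 𝒫_T(c,b)} x(γ) · (x_{i_1}/x_{i_0}) = ∑_{α ∈ 𝒫_T(a,b)_{i_1}} x(α), and (b) ∑_{γ ∈ 𝒫_T(d,b)} x(γ) · (x_{i_1'}/x_{i_0}) = ∑_{α ∈ 𝒫_T(a,b)_{i_1'}} x(α). (Lemma 2.7.) -/

import Mathlib

open scoped BigOperators Classical

noncomputable section

/-- The `k`-th vertex of the regular `(n+3)`-gon inscribed in the unit circle. -/
def vtx (n : ℕ) (k : Fin (n + 3)) : EuclideanSpace ℝ (Fin 2) :=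
  (WithLp.equiv 2 (Fin 2 → ℝ)).symm
    ![Real.cos (2 * Real.pi * k / (n + 3)), Real.sin (2 * Real.pi * k / (n + 3))]

/-- `u` and `v` are cyclically adjacent vertices of the `(n+3)`-gon. -/
def Adj (n : ℕ) (u v : Fin (n + 3)) : Prop :=
  (u.val + 1) % (n + 3) = v.val ∨ (v.val + 1) % (n + 3) = u.val

/-- The pair `(u, v)` is a diagonal of the polygon. -/
def IsDiag (n : ℕ) (u v : Fin (n + 3)) : Prop :=
  u ≠ v ∧ ¬ Adj n u v

/-- The open segments joining `u,v` and `w,z` intersect (the two edges cross). -/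
def Cross (n : ℕ) (u v w z : Fin (n + 3)) : Prop :=
  (openSegment ℝ (vtx n u) (vtx n v) ∩ openSegment ℝ (vtx n w) (vtx n z)).Nonempty

/-- `(u,v)` and `(w,z)` are the same unordered pair of vertices. -/
def SamePair (n : ℕ) (u v w z : Fin (n + 3)) : Prop :=
  (u = w ∧ v = z) ∨ (u = z ∧ v = w)

/-- A triangulation of the `(n+3)`-gon: `2n+3` edges, the first `n` of which are
pairwise noncrossing diagonals (a maximal such family), and the remaining `n+3`
are the boundary edges. -/
structure Triangulation (n : ℕ) where
  src : Fin (2 * n + 3) → Fin (n + 3)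
  tgt : Fin (2 * n + 3) → Fin (n + 3)
  diag : ∀ i : Fin (2 * n + 3), i.val < n → IsDiag n (src i) (tgt i)
  bdry : ∀ i : Fin (2 * n + 3), n ≤ i.val → Adj n (src i) (tgt i)
  inj : ∀ i j : Fin (2 * n + 3), SamePair n (src i) (tgt i) (src j) (tgt j) → i = j
  noncross : ∀ i j : Fin (2 * n + 3), i ≠ j → ¬ Cross n (src i) (tgt i) (src j) (tgt j)
  bdry_complete : ∀ u v : Fin (n + 3), Adj n u v →
    ∃ i : Fin (2 * n + 3), n ≤ i.val ∧ SamePair n (src i) (tgt i) u v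
  maximal : ∀ u v : Fin (n + 3), IsDiag n u v →
    (∀ i : Fin (2 * n + 3), i.val < n → ¬ Cross n u v (src i) (tgt i)) →
    ∃ i : Fin (2 * n + 3), i.val < n ∧ SamePair n (src i) (tgt i) u v

/-- The edge `T_i` joins the vertices `u` and `v`. -/
def Joins (n : ℕ) (T : Triangulation n) (i : Fin (2 * n + 3)) (u v : Fin (n + 3)) : Prop :=
  SamePair n (T.src i) (T.tgt i) u v

/-- The edge `T_i` crosses the segment from `u` to `v`. -/
def ECross (n : ℕ) (T : Triangulation n) (i : Fin (2 * n + 3)) (u v : Fin (n + 3)) : Prop :=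
  Cross n (T.src i) (T.tgt i) u v

/-- The set of crossing points of the edge `T_i` with the segment from `u` to `v`. -/
def crossPts (n : ℕ) (T : Triangulation n) (i : Fin (2 * n + 3)) (u v : Fin (n + 3)) :
    Set (EuclideanSpace ℝ (Fin 2)) :=
  openSegment ℝ (vtx n (T.src i)) (vtx n (T.tgt i)) ∩ openSegment ℝ (vtx n u) (vtx n v)

/-- A default edge index. -/
def edef (n : ℕ) : Fin (2 * n + 3) := ⟨0, by omega⟩

/-- The data of a path: the list of vertices `a_0,…,a_ℓ` and the list of
edge indices `i_1,…,i_ℓ`. -/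
abbrev PathData (n : ℕ) := List (Fin (n + 3)) × List (Fin (2 * n + 3))

/-- `p` is a `T`-path from `a` to `b`: conditions (T1)–(T6). -/
def IsTPath (n : ℕ) (T : Triangulation n) (a b : Fin (n + 3)) (p : PathData n) : Prop :=
  -- the vertex list has one more entry than the edge list
  p.1.length = p.2.length + 1 ∧
  -- (T1)
  p.1.head? = some a ∧ p.1.getLast? = some b ∧
  -- (T2)
  (∀ k, k < p.2.length →
      Joins n T (p.2.getD k (edef n)) (p.1.getD k a) (p.1.getD (k + 1) a)) ∧
  -- (T3)
  p.2.Nodup ∧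
  -- (T4)
  Odd p.2.length ∧
  -- (T5) (list position `k` carries the `(k+1)`-st edge of the path)
  (∀ k, k < p.2.length → k % 2 = 1 → ECross n T (p.2.getD k (edef n)) a b) ∧
  -- (T6)
  (∀ j k, j < k → k < p.2.length →
      ∀ x ∈ crossPts n T (p.2.getD j (edef n)) a b,
      ∀ y ∈ crossPts n T (p.2.getD k (edef n)) a b,
        dist (vtx n a) x < dist (vtx n a) y)

/-- `𝒫_T(a,b)`: the set of `T`-paths from `a` to `b`. -/
def TPaths (n : ℕ) (T : Triangulation n) (a b : Fin (n + 3)) : Set (PathData n) :=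
  { p | IsTPath n T a b p }

/-- `𝒫_T(a,b)_j`: `T`-paths from `a` to `b` whose first edge is `T_j`. -/
def TPathsFirst (n : ℕ) (T : Triangulation n) (a b : Fin (n + 3)) (j : Fin (2 * n + 3)) :
    Set (PathData n) :=
  { p ∈ TPaths n T a b | p.2.head? = some j }

/-- `𝒫_T(a,b)_{-j}`: `T`-paths from `a` to `b` not containing the index `j`. -/
def TPathsAvoid (n : ℕ) (T : Triangulation n) (a b : Fin (n + 3)) (j : Fin (2 * n + 3)) :
    Set (PathData n) :=
  { p ∈ TPaths n T a b | j ∉ p.2 }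

/-- `𝒫_T(a,b)_{jk}`: `T`-paths from `a` to `b` whose first two edges are `T_j, T_k`. -/
def TPathsFirst2 (n : ℕ) (T : Triangulation n) (a b : Fin (n + 3))
    (j k : Fin (2 * n + 3)) : Set (PathData n) :=
  { p ∈ TPathsFirst n T a b j | p.2[1]? = some k }

/-- `𝒫_T(a,b)_{j,-k}`: `T`-paths from `a` to `b` whose first edge is `T_j` and which do
not contain the index `k`. -/
def TPathsFirstAvoid (n : ℕ) (T : Triangulation n) (a b : Fin (n + 3))
    (j k : Fin (2 * n + 3)) : Set (PathData n) :=
  { p ∈ TPathsFirst n T a b j | k ∉ p.2 }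

/-- The ambient field `F = ℚ(x_1,…,x_{2n+3})`. -/
abbrev F (n : ℕ) := FractionRing (MvPolynomial (Fin (2 * n + 3)) ℚ)

/-- The variable `x_i ∈ F` attached to the edge `T_i`. -/
def X (n : ℕ) (i : Fin (2 * n + 3)) : F n :=
  algebraMap (MvPolynomial (Fin (2 * n + 3)) ℚ) (F n) (MvPolynomial.X i)

/-- `x(α)` for a path with edge list `es = [i_1,…,i_ℓ]`: the product of the
variables of the odd edges times the inverse of the product of the variables of
the even edges (list position `k` carries the `(k+1)`-st edge). -/
def pathX (n : ℕ) (es : List (Fin (2 * n + 3))) : F n :=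
  (∏ k ∈ (Finset.range es.length).filter (fun k => k % 2 = 0), X n (es.getD k (edef n))) *
  (∏ k ∈ (Finset.range es.length).filter (fun k => k % 2 = 1), X n (es.getD k (edef n)))⁻¹

end

/-- Twice the signed area of the triangle `p q z`. -/
noncomputable def orient (p q z : EuclideanSpace ℝ (Fin 2)) : ℝ :=
  (q 0 - p 0) * (z 1 - p 1) - (q 1 - p 1) * (z 0 - p 0)

lemma orient_swap (p q z : EuclideanSpace ℝ (Fin 2)) : orient q p z = -orient p q z := by
  simp only [orient]; ring

lemma orient_combo (p q u v : EuclideanSpace ℝ (Fin 2)) {s t : ℝ} (h : s + t = 1) :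
    orient p q (s • u + t • v) = s * orient p q u + t * orient p q v := by
  obtain rfl : s = 1 - t := by linarith
  simp only [orient, PiLp.add_apply, PiLp.smul_apply, smul_eq_mul]; ring

lemma orient_eq_zero_of_mem {p q z : EuclideanSpace ℝ (Fin 2)} (h : z ∈ openSegment ℝ p q) :
    orient p q z = 0 := by
  obtain ⟨s, t, -, -, hst, rfl⟩ := h
  rw [orient_combo _ _ _ _ hst]
  simp only [orient]; ring

lemma openSegment_inter_nonempty {p q u v : EuclideanSpace ℝ (Fin 2)}
    (hu : 0 < orient p q u) (hv : orient p q v < 0)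
    (hp : orient u v p < 0) (hq : 0 < orient u v q) :
    (openSegment ℝ p q ∩ openSegment ℝ u v).Nonempty := by
  have hW : orient u v q - orient u v p = orient p q u - orient p q v := by
    simp only [orient]; ring
  have h1 : 0 < orient u v q - orient u v p := by linarith
  have h2 : 0 < orient p q u - orient p q v := by linarith
  refine ⟨(orient u v q / (orient u v q - orient u v p)) • p +
    (-orient u v p / (orient u v q - orient u v p)) • q,
    ⟨_, _, div_pos hq h1, div_pos (by linarith) h1, by field_simp; ring, rfl⟩,
    ⟨-orient p q v / (orient p q u - orient p q v), orient p q u / (orient p q u - orient p q v),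
      div_pos (by linarith) h2, div_pos hu h2, by field_simp; ring, ?_⟩⟩
  rw [hW]
  ext i
  fin_cases i <;>
  · simp only [PiLp.add_apply, PiLp.smul_apply, smul_eq_mul, Fin.zero_eta, Fin.mk_one]
    field_simp
    simp only [orient]; ring

/-- If `p', q'` lie on the same closed side of the line `p q` as `v`, then the segment `u v`
meets `p q` before it meets `p' q'`. -/
lemma dist_lt_dist_of_orient {p q p' q' u v x y : EuclideanSpace ℝ (Fin 2)}
    (hu : orient p q u < 0) (hv : 0 < orient p q v)
    (hp' : 0 ≤ orient p q p') (hq' : 0 ≤ orient p q q')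
    (hne : 0 < orient p q p' ∨ 0 < orient p q q')
    (hx : x ∈ openSegment ℝ p q) (hx' : x ∈ openSegment ℝ u v)
    (hy : y ∈ openSegment ℝ p' q') (hy' : y ∈ openSegment ℝ u v) :
    dist u x < dist u y := by
  have hx0 := orient_eq_zero_of_mem hx
  have hy0 : 0 < orient p q y := by
    obtain ⟨s, t, hs, ht, hst, rfl⟩ := hy
    rw [orient_combo _ _ _ _ hst]
    rcases hne with h | h
    · have := mul_pos hs h; have := mul_nonneg ht.le hq'; linarith
    · have := mul_nonneg hs.le hp'; have := mul_pos ht h; linarith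
  have huv : 0 < dist u v := by
    rw [dist_pos]; rintro rfl; linarith
  obtain ⟨s, t, hs, ht, hst, rfl⟩ := hx'
  obtain ⟨s', t', hs', ht', hst', rfl⟩ := hy'
  rw [orient_combo _ _ _ _ hst] at hx0
  rw [orient_combo _ _ _ _ hst'] at hy0
  have key : ∀ s t : ℝ, 0 < t → s + t = 1 → dist u (s • u + t • v) = t * dist u v := by
    intro s t ht h
    obtain rfl : s = 1 - t := by linarith
    rw [dist_eq_norm, dist_eq_norm, show u - ((1 - t) • u + t • v) = t • (u - v) by module,
      norm_smul, Real.norm_eq_abs, abs_of_pos ht]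
  rw [key s t ht hst, key s' t' ht' hst']
  refine mul_lt_mul_of_pos_right ?_ huv
  obtain rfl : s = 1 - t := by linarith
  obtain rfl : s' = 1 - t' := by linarith
  nlinarith

/-- The position of the vertex `u` counted counterclockwise from `a`. -/
def pos (n : ℕ) (a u : Fin (n + 3)) : ℕ := (u - a).val

lemma pos_lt (n : ℕ) (a u : Fin (n + 3)) : pos n a u < n + 3 := (u - a).isLt

lemma pos_self (n : ℕ) (a : Fin (n + 3)) : pos n a a = 0 := by simp [pos]

lemma pos_inj {n : ℕ} {a u v : Fin (n + 3)} : pos n a u = pos n a v ↔ u = v := by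
  simp [pos, Fin.val_inj]

lemma exists_pos_eq (n : ℕ) (a u : Fin (n + 3)) :
    ∃ m : ℕ, a.val + pos n a u = u.val + m * (n + 3) := by
  have h1 := a.isLt
  have h2 := u.isLt
  rw [pos, Fin.val_sub]
  rcases le_or_gt a.val u.val with h | h
  · refine ⟨0, ?_⟩
    rw [show n + 3 - a.val + u.val = (u.val - a.val) + (n + 3) by omega, Nat.add_mod_right,
      Nat.mod_eq_of_lt (by omega)]
    omega
  · refine ⟨1, ?_⟩
    rw [Nat.mod_eq_of_lt (by omega)]
    omega

/-- Half of the angle of the vertex `u`, normalised by starting at the vertex `a`. -/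
noncomputable def halfAngle (n : ℕ) (a u : Fin (n + 3)) : ℝ :=
  Real.pi * (a.val + pos n a u : ℕ) / (n + 3)

lemma vtx_coords (n : ℕ) (a u : Fin (n + 3)) :
    vtx n u 0 = Real.cos (2 * halfAngle n a u) ∧ vtx n u 1 = Real.sin (2 * halfAngle n a u) := by
  obtain ⟨m, hm⟩ := exists_pos_eq n a u
  have hN : (n : ℝ) + 3 ≠ 0 := by positivity
  have h : 2 * halfAngle n a u = 2 * Real.pi * u.val / (n + 3) + m * (2 * Real.pi) := by
    rw [halfAngle, hm]; push_cast; field_simp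
  rw [h, Real.cos_add_nat_mul_two_pi, Real.sin_add_nat_mul_two_pi]
  simp [vtx]

lemma orient_vtx (n : ℕ) (a u v w : Fin (n + 3)) :
    orient (vtx n u) (vtx n v) (vtx n w) =
      4 * Real.sin (halfAngle n a v - halfAngle n a u) *
        Real.sin (halfAngle n a w - halfAngle n a u) *
        Real.sin (halfAngle n a w - halfAngle n a v) := by
  obtain ⟨hu0, hu1⟩ := vtx_coords n a u
  obtain ⟨hv0, hv1⟩ := vtx_coords n a v
  obtain ⟨hw0, hw1⟩ := vtx_coords n a w
  rw [orient, hu0, hu1, hv0, hv1, hw0, hw1]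
  generalize halfAngle n a u = A
  generalize halfAngle n a v = B
  generalize halfAngle n a w = C
  rw [Real.cos_sub_cos, Real.cos_sub_cos, Real.sin_sub_sin, Real.sin_sub_sin,
    show C - B = (C + A) - (B + A) by ring, Real.sin_sub (C + A)]
  ring_nf

lemma sin_halfAngle_pos {n : ℕ} {a u v : Fin (n + 3)} (h : pos n a u < pos n a v) :
    0 < Real.sin (halfAngle n a v - halfAngle n a u) := by
  have hN : (0 : ℝ) < n + 3 := by positivity
  have hv : (pos n a v : ℝ) < n + 3 := by exact_mod_cast pos_lt n a v
  have hu : (0 : ℝ) ≤ pos n a u := by positivity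
  have h' : (pos n a u : ℝ) < pos n a v := by exact_mod_cast h
  have e : halfAngle n a v - halfAngle n a u =
      Real.pi * ((pos n a v - pos n a u : ℝ) / (n + 3)) := by
    rw [halfAngle, halfAngle]; push_cast; field_simp; ring
  rw [e]
  have hp := Real.pi_pos
  refine Real.sin_pos_of_pos_of_lt_pi (mul_pos hp (div_pos (by linarith) hN)) ?_
  have : (pos n a v - pos n a u : ℝ) / (n + 3) < 1 := by
    rw [div_lt_one hN]; linarith
  nlinarith

/-- Positions `i, j, k` occur in counterclockwise order. -/
def Ccw (i j k : ℕ) : Prop := (i < j ∧ j < k) ∨ (j < k ∧ k < i) ∨ (k < i ∧ i < j)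

lemma orient_pos_of_ccw {n : ℕ} (a : Fin (n + 3)) {u v w : Fin (n + 3)}
    (h : Ccw (pos n a u) (pos n a v) (pos n a w)) :
    0 < orient (vtx n u) (vtx n v) (vtx n w) := by
  have key : ∀ {u v w : Fin (n + 3)}, pos n a u < pos n a v → pos n a v < pos n a w →
      0 < orient (vtx n u) (vtx n v) (vtx n w) := by
    intro u v w h1 h2
    rw [orient_vtx n a]
    have := sin_halfAngle_pos h1
    have := sin_halfAngle_pos h2
    have := sin_halfAngle_pos (h1.trans h2)
    positivity
  have cyc : ∀ p q z : EuclideanSpace ℝ (Fin 2), orient p q z = orient q z p := by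
    intro p q z; simp only [orient]; ring
  rcases h with ⟨h1, h2⟩ | ⟨h1, h2⟩ | ⟨h1, h2⟩
  · exact key h1 h2
  · rw [cyc]; exact key h1 h2
  · rw [← cyc]; exact key h1 h2

lemma orient_neg_of_ccw {n : ℕ} (a : Fin (n + 3)) {u v w : Fin (n + 3)}
    (h : Ccw (pos n a v) (pos n a u) (pos n a w)) :
    orient (vtx n u) (vtx n v) (vtx n w) < 0 := by
  have := orient_pos_of_ccw a h
  rw [orient_swap] at this
  linarith

/-- The chords `p q` and `s t`, given by positions, are strictly interleaved. -/
def Interleaved (p q s t : ℕ) : Prop :=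
  (Ccw p q s ∧ Ccw q p t) ∨ (Ccw q p s ∧ Ccw p q t)

lemma Cross.congr {n : ℕ} {u v w z u' v' w' z' : Fin (n + 3)} (h : Cross n u v w z)
    (h1 : SamePair n u v u' v') (h2 : SamePair n w z w' z') : Cross n u' v' w' z' := by
  rcases h1 with ⟨rfl, rfl⟩ | ⟨rfl, rfl⟩ <;> rcases h2 with ⟨rfl, rfl⟩ | ⟨rfl, rfl⟩
  · exact h
  · rwa [Cross, openSegment_symm ℝ (vtx n z)] at *
  · rwa [Cross, openSegment_symm ℝ (vtx n v)] at *
  · rwa [Cross, openSegment_symm ℝ (vtx n v), openSegment_symm ℝ (vtx n z)] at *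

lemma Cross.interleaved {n : ℕ} (a : Fin (n + 3)) {u v w z : Fin (n + 3)}
    (h : Cross n u v w z) (huv : u ≠ v) (hwz : w ≠ z) (hs : ¬ SamePair n u v w z) :
    Interleaved (pos n a u) (pos n a v) (pos n a w) (pos n a z) := by
  obtain ⟨x, hx, s, t, hs', ht', hst, hx'⟩ := h
  have h0 := orient_eq_zero_of_mem hx
  rw [← hx', orient_combo _ _ _ _ hst] at h0
  have tri : ∀ w : Fin (n + 3), w ≠ u → w ≠ v →
      Ccw (pos n a u) (pos n a v) (pos n a w) ∨ Ccw (pos n a v) (pos n a u) (pos n a w) := by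
    intro w h1 h2
    rw [Ne, ← pos_inj (a := a)] at h1 h2 huv
    simp only [Ccw]; omega
  have zl : orient (vtx n u) (vtx n v) (vtx n u) = 0 := by simp only [orient]; ring
  have zr : orient (vtx n u) (vtx n v) (vtx n v) = 0 := by simp only [orient]; ring
  have nz : ∀ w : Fin (n + 3), orient (vtx n u) (vtx n v) (vtx n w) = 0 → w = u ∨ w = v := by
    intro w hw
    by_contra! hc
    rcases tri w hc.1 hc.2 with h | h
    · exact (orient_pos_of_ccw a h).ne' hw
    · exact (orient_neg_of_ccw a h).ne hw
  by_cases hw : w = u ∨ w = v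
  · have hw0 : orient (vtx n u) (vtx n v) (vtx n w) = 0 := by
      rcases hw with rfl | rfl <;> assumption
    rw [hw0, mul_zero, zero_add, mul_eq_zero, or_iff_right ht'.ne'] at h0
    have hz := nz z h0
    exfalso
    apply hs
    rcases hw with rfl | rfl <;> rcases hz with rfl | rfl <;> simp_all [SamePair]
  by_cases hz : z = u ∨ z = v
  · have hz0 : orient (vtx n u) (vtx n v) (vtx n z) = 0 := by
      rcases hz with rfl | rfl <;> assumption
    rw [hz0, mul_zero, add_zero, mul_eq_zero, or_iff_right hs'.ne'] at h0
    exact absurd (nz w h0) hw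
  push Not at hw hz
  rcases tri w hw.1 hw.2 with h1 | h1 <;> rcases tri z hz.1 hz.2 with h2 | h2
  · have := mul_pos hs' (orient_pos_of_ccw a h1)
    have := mul_pos ht' (orient_pos_of_ccw a h2)
    linarith
  · exact Or.inl ⟨h1, h2⟩
  · exact Or.inr ⟨h1, h2⟩
  · have := mul_neg_of_pos_of_neg hs' (orient_neg_of_ccw a h1)
    have := mul_neg_of_pos_of_neg ht' (orient_neg_of_ccw a h2)
    linarith

lemma cross_of_interleaved {n : ℕ} (a : Fin (n + 3)) {u v w z : Fin (n + 3)}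
    (h : Interleaved (pos n a u) (pos n a v) (pos n a w) (pos n a z)) : Cross n u v w z := by
  have key : ∀ {w z : Fin (n + 3)}, Ccw (pos n a u) (pos n a v) (pos n a w) →
      Ccw (pos n a v) (pos n a u) (pos n a z) → Cross n u v w z := by
    intro w z h1 h2
    refine openSegment_inter_nonempty (orient_pos_of_ccw a h1) (orient_neg_of_ccw a h2)
      (orient_neg_of_ccw a ?_) (orient_pos_of_ccw a ?_) <;> simp only [Ccw] at * <;> omega
  rcases h with h | h
  · exact key h.1 h.2
  · exact (key h.2 h.1).congr (Or.inl ⟨rfl, rfl⟩) (Or.inr ⟨rfl, rfl⟩)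

section Edges

variable {n : ℕ} {T : Triangulation n} {i j : Fin (2 * n + 3)} {u v w z : Fin (n + 3)}

lemma Joins.symm (h : Joins n T i u v) : Joins n T i v u := Or.symm h

lemma Joins.ne (h : Joins n T i u v) : u ≠ v := by
  have key : T.src i ≠ T.tgt i := by
    rcases lt_or_ge i.val n with hi | hi
    · exact (T.diag i hi).1
    · intro he
      have hb := T.bdry i hi
      have := (T.tgt i).isLt
      rw [Adj, he, or_self] at hb
      rcases (show (T.tgt i).val + 1 < n + 3 ∨ (T.tgt i).val + 1 = n + 3 by omega) with h | h
      · rw [Nat.mod_eq_of_lt h] at hb; omega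
      · rw [h, Nat.mod_self] at hb; omega
  rcases h with ⟨rfl, rfl⟩ | ⟨rfl, rfl⟩
  · exact key
  · exact key.symm

lemma Joins.index_eq (h : Joins n T i u v) (h' : Joins n T j u v) : i = j := by
  apply T.inj
  simp only [Joins, SamePair] at *
  grind

lemma Joins.right_eq (h : Joins n T i u v) (h' : Joins n T i u w) : v = w := by
  simp only [Joins, SamePair] at *
  grind

lemma Joins.samePair (h : Joins n T i u v) (h' : Joins n T i w z) : SamePair n u v w z := by
  simp only [Joins, SamePair] at *
  grind

lemma Joins.ecross_iff (h : Joins n T i u v) : ECross n T i w z ↔ Cross n u v w z := by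
  refine ⟨fun hc => hc.congr h (Or.inl ⟨rfl, rfl⟩), fun hc => hc.congr ?_ (Or.inl ⟨rfl, rfl⟩)⟩
  simp only [Joins, SamePair] at *
  grind

lemma Joins.not_interleaved (a : Fin (n + 3)) (h : Joins n T i u v) (h' : Joins n T j w z) :
    ¬ Interleaved (pos n a u) (pos n a v) (pos n a w) (pos n a z) := by
  intro hI
  by_cases hij : i = j
  · subst hij
    rcases h.samePair h' with ⟨rfl, rfl⟩ | ⟨rfl, rfl⟩ <;> simp only [Interleaved, Ccw] at hI <;> omega
  · exact T.noncross i j hij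
      ((cross_of_interleaved a hI).congr (by simp only [Joins, SamePair] at *; grind)
        (by simp only [Joins, SamePair] at *; grind))

lemma interleaved_iff {p q s t : ℕ} (h : p < q) : Interleaved p q s t ↔
    (p < s ∧ s < q ∧ (t < p ∨ q < t)) ∨ (p < t ∧ t < q ∧ (s < p ∨ q < s)) := by
  simp only [Interleaved, Ccw]
  omega

lemma exists_joins_lt (a : Fin (n + 3)) (i : Fin (2 * n + 3)) :
    ∃ p q, Joins n T i p q ∧ pos n a p < pos n a q := by
  have hj : Joins n T i (T.src i) (T.tgt i) := Or.inl ⟨rfl, rfl⟩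
  rcases lt_or_gt_of_ne (mt pos_inj.1 hj.ne : pos n a (T.src i) ≠ pos n a (T.tgt i)) with h | h
  · exact ⟨_, _, hj, h⟩
  · exact ⟨_, _, hj.symm, h⟩

/-- The edge `T_i` has `u` as an endpoint. -/
def Incident (n : ℕ) (T : Triangulation n) (i : Fin (2 * n + 3)) (u : Fin (n + 3)) : Prop :=
  ∃ v, Joins n T i u v

/-- On the segment from `u` to `v`, every crossing with `T_i` comes before every crossing with
`T_j`. -/
def Before (n : ℕ) (T : Triangulation n) (u v : Fin (n + 3)) (i j : Fin (2 * n + 3)) : Prop :=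
  ∀ x ∈ crossPts n T i u v, ∀ y ∈ crossPts n T j u v, dist (vtx n u) x < dist (vtx n u) y

lemma Before.asymm (h : Before n T u v i j) (hi : ECross n T i u v) (hj : ECross n T j u v) :
    ¬ Before n T u v j i := by
  intro h'
  obtain ⟨x, hx⟩ := hi
  obtain ⟨y, hy⟩ := hj
  exact lt_asymm (h x hx y hy) (h' y hy x hx)

lemma before_of_not_ecross_left (hi : ¬ ECross n T i u v) : Before n T u v i j :=
  fun x hx => absurd ⟨x, hx⟩ hi

lemma before_of_not_ecross_right (hj : ¬ ECross n T j u v) : Before n T u v i j :=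
  fun _ _ y hy => absurd ⟨y, hy⟩ hj

lemma Joins.openSegment_eq (h : Joins n T i u v) :
    openSegment ℝ (vtx n (T.src i)) (vtx n (T.tgt i)) = openSegment ℝ (vtx n u) (vtx n v) := by
  rcases h with ⟨h1, h2⟩ | ⟨h1, h2⟩
  · rw [h1, h2]
  · rw [h1, h2, openSegment_symm]

lemma before_of_nested (a : Fin (n + 3)) {p q p' q' : Fin (n + 3)}
    (hi : Joins n T i p q) (hj : Joins n T j p' q') (hij : i ≠ j)
    (hv : pos n a p < pos n a v ∧ pos n a v < pos n a q)
    (hu : pos n a u < pos n a p ∨ pos n a q < pos n a u)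
    (hp : pos n a p ≤ pos n a p') (hpq : pos n a p' < pos n a q')
    (hq : pos n a q' ≤ pos n a q) : Before n T u v i j := by
  rintro x ⟨hx, hx'⟩ y ⟨hy, hy'⟩
  rw [hi.symm.openSegment_eq] at hx
  rw [hj.openSegment_eq] at hy
  have side : ∀ z, pos n a p ≤ pos n a z → pos n a z ≤ pos n a q →
      0 ≤ orient (vtx n q) (vtx n p) (vtx n z) := by
    intro z h1 h2
    rcases h1.eq_or_lt with h1 | h1
    · obtain rfl := pos_inj.1 h1
      simp only [orient]; apply le_of_eq; ring
    rcases h2.eq_or_lt with h2 | h2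
    · obtain rfl := pos_inj.1 h2
      simp only [orient]; apply le_of_eq; ring
    · exact (orient_pos_of_ccw a (by simp only [Ccw]; omega)).le
  refine dist_lt_dist_of_orient (orient_neg_of_ccw a ?_) (orient_pos_of_ccw a ?_)
    (side p' hp (by omega)) (side q' (by omega) hq) ?_ hx hx' hy hy'
  · simp only [Ccw]; omega
  · simp only [Ccw]; omega
  · by_contra! hc
    apply hij
    have hpp : p = p' := by
      by_contra hne
      rw [← pos_inj (a := a)] at hne
      exact hc.1.not_gt (orient_pos_of_ccw a (by simp only [Ccw]; omega))
    have hqq : q = q' := by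
      by_contra hne
      rw [← pos_inj (a := a)] at hne
      exact hc.2.not_gt (orient_pos_of_ccw a (by simp only [Ccw]; omega))
    subst hpp hqq
    exact hi.index_eq hj

end Edges

/-- The edges `T_{i_0} = c d`, `T_{i_1'} = a c` and `T_{i_1} = a d` form a triangle of `T` at `a`,
and `T_{i_0}` crosses the segment from `a` to `b`, which is not an edge of `T`. -/
structure FirstTriangle (n : ℕ) (T : Triangulation n) (a b c d : Fin (n + 3))
    (i0 i1 i1' : Fin (2 * n + 3)) : Prop where
  ne : a ≠ b
  not_joins : ∀ i, ¬ Joins n T i a b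
  ecross : ECross n T i0 a b
  joins_cd : Joins n T i0 c d
  joins_ac : Joins n T i1' a c
  joins_ad : Joins n T i1 a d

namespace FirstTriangle

variable {n : ℕ} {T : Triangulation n} {a b c d : Fin (n + 3)} {i0 i1 i1' : Fin (2 * n + 3)}
  {i j : Fin (2 * n + 3)}

lemma symm (h : FirstTriangle n T a b c d i0 i1 i1') : FirstTriangle n T a b d c i0 i1' i1 :=
  ⟨h.ne, h.not_joins, h.ecross, h.joins_cd.symm, h.joins_ad, h.joins_ac⟩

lemma exists_joins_of_ecross (h : FirstTriangle n T a b c d i0 i1 i1') (hi : ECross n T i a b) :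
    ∃ p q, Joins n T i p q ∧ 0 < pos n a p ∧ pos n a p < pos n a b ∧ pos n a b < pos n a q := by
  have hj : Joins n T i (T.src i) (T.tgt i) := Or.inl ⟨rfl, rfl⟩
  have hI := hi.interleaved a hj.ne h.ne (h.not_joins i)
  have ha := pos_self n a
  simp only [Interleaved, Ccw, ha] at hI
  by_cases hlt : pos n a (T.src i) < pos n a (T.tgt i)
  · exact ⟨_, _, hj, by omega⟩
  · exact ⟨_, _, hj.symm, by omega⟩

lemma pos_cases (h : FirstTriangle n T a b c d i0 i1 i1') :
    (0 < pos n a c ∧ pos n a c < pos n a b ∧ pos n a b < pos n a d) ∨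
      (0 < pos n a d ∧ pos n a d < pos n a b ∧ pos n a b < pos n a c) := by
  obtain ⟨p, q, hj, hp⟩ := h.exists_joins_of_ecross h.ecross
  rcases hj.samePair h.joins_cd with ⟨rfl, rfl⟩ | ⟨rfl, rfl⟩ <;> omega

lemma c_ne_b (h : FirstTriangle n T a b c d i0 i1 i1') : c ≠ b := by
  rw [Ne, ← pos_inj (a := a)]
  have := h.pos_cases
  omega

lemma bounds (h : FirstTriangle n T a b c d i0 i1 i1') {p q : Fin (n + 3)}
    (hj : Joins n T i p q) (hp : 0 < pos n a p ∧ pos n a p < pos n a b ∧ pos n a b < pos n a q) :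
    (0 < pos n a c ∧ pos n a c ≤ pos n a p ∧ pos n a q ≤ pos n a d) ∨
      (0 < pos n a d ∧ pos n a d ≤ pos n a p ∧ pos n a q ≤ pos n a c) := by
  have h1 := hj.not_interleaved a h.joins_ac
  have h2 := hj.not_interleaved a h.joins_ad
  have := h.pos_cases
  rw [pos_self] at h1 h2
  simp only [Interleaved, Ccw] at h1 h2
  omega

lemma nested {p q p' q' : Fin (n + 3)}
    (hj : Joins n T i p q) (hp : 0 < pos n a p ∧ pos n a p < pos n a b ∧ pos n a b < pos n a q)
    (hj' : Joins n T j p' q')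
    (hp' : 0 < pos n a p' ∧ pos n a p' < pos n a b ∧ pos n a b < pos n a q') :
    (pos n a p ≤ pos n a p' ∧ pos n a q' ≤ pos n a q) ∨
      (pos n a p' ≤ pos n a p ∧ pos n a q ≤ pos n a q') := by
  have h1 := hj.not_interleaved a hj'
  simp only [Interleaved, Ccw] at h1
  omega

lemma incident_iff {p q : Fin (n + 3)} (hj : Joins n T i p q) (u : Fin (n + 3)) :
    Incident n T i u ↔ u = p ∨ u = q := by
  constructor
  · rintro ⟨v, hv⟩
    rcases hv.samePair hj with ⟨h, -⟩ | ⟨h, -⟩ <;> simp [h]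
  · rintro (rfl | rfl)
    exacts [⟨_, hj⟩, ⟨_, hj.symm⟩]

lemma before_or_before (h : FirstTriangle n T a b c d i0 i1 i1') (hij : i ≠ j)
    (hi : ECross n T i a b) (hj : ECross n T j a b)
    (hic : ¬ Incident n T i c) (hjc : ¬ Incident n T j c) :
    (Before n T a b i j ∧ Before n T c b i j) ∨ (Before n T a b j i ∧ Before n T c b j i) := by
  obtain ⟨p, q, hpq, hp⟩ := h.exists_joins_of_ecross hi
  obtain ⟨p', q', hpq', hp'⟩ := h.exists_joins_of_ecross hj
  have b1 := h.bounds hpq hp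
  have b2 := h.bounds hpq' hp'
  rw [incident_iff hpq, ← pos_inj (a := a), ← pos_inj (a := a)] at hic
  rw [incident_iff hpq', ← pos_inj (a := a), ← pos_inj (a := a)] at hjc
  have ha := pos_self n a
  rcases nested hpq hp hpq' hp' with hn | hn
  · left
    constructor <;> apply before_of_nested a hpq hpq' hij <;> omega
  · right
    constructor <;> apply before_of_nested a hpq' hpq hij.symm <;> omega

lemma before_of_incident (h : FirstTriangle n T a b c d i0 i1 i1')
    (hi : ECross n T i a b) (hj : ECross n T j a b)
    (hic : Incident n T i c) (hjc : ¬ Incident n T j c) : Before n T a b i j := by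
  have hij : i ≠ j := by rintro rfl; exact hjc hic
  obtain ⟨p, q, hpq, hp⟩ := h.exists_joins_of_ecross hi
  obtain ⟨p', q', hpq', hp'⟩ := h.exists_joins_of_ecross hj
  have b1 := h.bounds hpq hp
  have b2 := h.bounds hpq' hp'
  rw [incident_iff hpq, ← pos_inj (a := a), ← pos_inj (a := a)] at hic
  rw [incident_iff hpq', ← pos_inj (a := a), ← pos_inj (a := a)] at hjc
  have ha := pos_self n a
  have hn := nested hpq hp hpq' hp'
  apply before_of_nested a hpq hpq' hij <;> omega

lemma before_of_ne (h : FirstTriangle n T a b c d i0 i1 i1') (hj : j ≠ i0) :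
    Before n T a b i0 j := by
  by_cases hcj : ECross n T j a b
  · obtain ⟨p, q, hpq, hp⟩ := h.exists_joins_of_ecross hcj
    have b1 := h.bounds hpq hp
    have ha := pos_self n a
    have := h.pos_cases
    rcases b1 with b1 | b1
    · apply before_of_nested a h.joins_cd hpq hj.symm <;> omega
    · apply before_of_nested a h.joins_cd.symm hpq hj.symm <;> omega
  · exact before_of_not_ecross_right hcj

lemma ecross_iff (h : FirstTriangle n T a b c d i0 i1 i1') :
    ECross n T i c b ∧ ¬ Joins n T i c b ↔ ECross n T i a b ∧ ¬ Incident n T i c := by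
  have ha := pos_self n a
  have hcd := h.pos_cases
  constructor
  · rintro ⟨hi, hn⟩
    obtain ⟨p, q, hj, hpq⟩ := exists_joins_lt (T := T) a i
    have hI := (hj.ecross_iff.1 hi).interleaved a hj.ne h.c_ne_b fun hs => hn (by
      simp only [Joins, SamePair] at *; grind)
    have h1 := hj.not_interleaved a h.joins_ac
    have h2 := hj.not_interleaved a h.joins_cd
    rw [ha] at h1
    rw [interleaved_iff hpq] at hI h1 h2
    have : Interleaved (pos n a p) (pos n a q) (pos n a a) (pos n a b) := by
      rw [ha, interleaved_iff hpq]
      omega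
    refine ⟨hj.ecross_iff.2 (cross_of_interleaved a this), ?_⟩
    rw [incident_iff hj, ← pos_inj (a := a), ← pos_inj (a := a)]
    omega
  · rintro ⟨hi, hn⟩
    obtain ⟨p, q, hpq, hp⟩ := h.exists_joins_of_ecross hi
    have b1 := h.bounds hpq hp
    refine ⟨hpq.ecross_iff.2 (cross_of_interleaved a ?_), fun hc => hn ⟨_, hc⟩⟩
    rw [incident_iff hpq, ← pos_inj (a := a), ← pos_inj (a := a)] at hn
    simp only [Interleaved, Ccw]
    omega

lemma not_incident_a (h : FirstTriangle n T a b c d i0 i1 i1') (hi : ECross n T i a b) :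
    ¬ Incident n T i a := by
  obtain ⟨p, q, hpq, hp⟩ := h.exists_joins_of_ecross hi
  rw [incident_iff hpq, ← pos_inj (a := a), ← pos_inj (a := a), pos_self]
  omega

lemma not_ecross_i1 (h : FirstTriangle n T a b c d i0 i1 i1') : ¬ ECross n T i1 a b :=
  fun hi => h.not_incident_a hi ⟨_, h.joins_ad⟩

/-- Among the edges crossing `a b`, those ending at `c` come first. -/
lemma not_incident_of_before (h : FirstTriangle n T a b c d i0 i1 i1')
    (hi : ECross n T i a b) (hj : ECross n T j a b) (hic : ¬ Incident n T i c)
    (hb : Before n T a b i j) : ¬ Incident n T j c :=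
  fun hjc => hb.asymm hi hj (h.before_of_incident hj hi hjc hic)

lemma before_ab (h : FirstTriangle n T a b c d i0 i1 i1') (hij : i ≠ j)
    (hic : ¬ Incident n T i c) (hjc : ¬ Incident n T j c) (hb : Before n T c b i j) :
    Before n T a b i j := by
  by_cases hi : ECross n T i a b
  swap; · exact before_of_not_ecross_left hi
  by_cases hj : ECross n T j a b
  swap; · exact before_of_not_ecross_right hj
  rcases h.before_or_before hij hi hj hic hjc with h' | h'
  · exact h'.1
  · exact absurd h'.2 (hb.asymm (h.ecross_iff.2 ⟨hi, hic⟩).1 (h.ecross_iff.2 ⟨hj, hjc⟩).1)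

lemma before_cb (h : FirstTriangle n T a b c d i0 i1 i1') (hij : i ≠ j)
    (hb : Before n T a b i j) : Before n T c b i j := by
  by_cases hi : ECross n T i c b
  swap; · exact before_of_not_ecross_left hi
  by_cases hj : ECross n T j c b
  swap; · exact before_of_not_ecross_right hj
  have hij' : ¬ ECross n T i (T.src j) (T.tgt j) := T.noncross i j hij
  have hji' : ¬ ECross n T j (T.src i) (T.tgt i) := T.noncross j i hij.symm
  have hin : ¬ Joins n T i c b := fun hn => hji' (Cross.congr hj (Or.inl ⟨rfl, rfl⟩) (by
    simp only [Joins, SamePair] at *; grind))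
  have hjn : ¬ Joins n T j c b := fun hn => hij' (Cross.congr hi (Or.inl ⟨rfl, rfl⟩) (by
    simp only [Joins, SamePair] at *; grind))
  obtain ⟨hi', hic⟩ := h.ecross_iff.1 ⟨hi, hin⟩
  obtain ⟨hj', hjc⟩ := h.ecross_iff.1 ⟨hj, hjn⟩
  rcases h.before_or_before hij hi' hj' hic hjc with h' | h'
  · exact h'.2
  · exact absurd h'.1 (hb.asymm hi' hj')

lemma not_ecross_i0 (h : FirstTriangle n T a b c d i0 i1 i1') : ¬ ECross n T i0 c b := by
  intro hc
  refine (h.ecross_iff.1 ⟨hc, fun hj => ?_⟩).2 ⟨_, h.joins_cd⟩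
  exact h.symm.c_ne_b (h.joins_cd.right_eq hj)

end FirstTriangle

lemma X_ne_zero (n : ℕ) (i : Fin (2 * n + 3)) : X n i ≠ 0 := by
  rw [X, Ne, IsFractionRing.to_map_eq_zero_iff]
  exact MvPolynomial.X_ne_zero i

lemma prod_range_succ_filter_mod {n : ℕ} (l : ℕ) (f : ℕ → F n) :
    (∏ k ∈ (Finset.range (l + 1)).filter (fun k => k % 2 = 0), f k) =
        f 0 * ∏ k ∈ (Finset.range l).filter (fun k => k % 2 = 1), f (k + 1) ∧
      (∏ k ∈ (Finset.range (l + 1)).filter (fun k => k % 2 = 1), f k) =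
        ∏ k ∈ (Finset.range l).filter (fun k => k % 2 = 0), f (k + 1) := by
  simp only [Finset.prod_filter, Finset.prod_range_succ' _ l]
  constructor
  · rw [mul_comm]
    congr 1
    refine Finset.prod_congr rfl fun k _ => ?_
    simp only [show (k + 1) % 2 = 0 ↔ k % 2 = 1 by omega]
  · rw [if_neg (by norm_num), mul_one]
    refine Finset.prod_congr rfl fun k _ => ?_
    simp only [show (k + 1) % 2 = 1 ↔ k % 2 = 0 by omega]

lemma pathX_cons (n : ℕ) (e : Fin (2 * n + 3)) (E : List (Fin (2 * n + 3))) :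
    pathX n (e :: E) = X n e * (pathX n E)⁻¹ := by
  obtain ⟨h1, h2⟩ := prod_range_succ_filter_mod E.length
    fun k => X n ((e :: E).getD k (edef n))
  rw [pathX, List.length_cons, h1, h2, pathX]
  simp only [List.getD_cons_zero, List.getD_cons_succ, mul_inv, inv_inv]
  ring

/-- The conditions defining a `T`-path, without default values. -/
structure TPathSpec (n : ℕ) (T : Triangulation n) (a b : Fin (n + 3)) (V : List (Fin (n + 3)))
    (E : List (Fin (2 * n + 3))) : Prop where
  length : V.length = E.length + 1
  first : V[0]? = some a
  last : V[E.length]? = some b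
  joins : ∀ k e u v, E[k]? = some e → V[k]? = some u → V[k + 1]? = some v → Joins n T e u v
  nodup : E.Nodup
  odd : Odd E.length
  ecross : ∀ k e, E[k]? = some e → k % 2 = 1 → ECross n T e a b
  before : E.Pairwise (Before n T a b)

lemma isTPath_iff {n : ℕ} {T : Triangulation n} {a b : Fin (n + 3)} {V : List (Fin (n + 3))}
    {E : List (Fin (2 * n + 3))} : IsTPath n T a b (V, E) ↔ TPathSpec n T a b V E := by
  have hget : ∀ {α : Type} (l : List α) (k : ℕ) (x y : α), l[k]? = some x → l.getD k y = x := by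
    intro α l k x y h
    simp [List.getD, h]
  have hget' : ∀ {α : Type} (l : List α) (k : ℕ) (y : α), k < l.length →
      l[k]? = some (l.getD k y) := by
    intro α l k y h
    simp [List.getD, h]
  constructor
  · rintro ⟨h1, h2, h3, h4, h5, h6, h7, h8⟩
    simp only at h1 h2 h3 h4 h5 h6 h7 h8
    refine ⟨h1, by rwa [← List.head?_eq_getElem?], ?_, ?_, h5, h6, ?_, ?_⟩
    · rw [List.getLast?_eq_getElem?, h1] at h3
      simpa using h3
    · intro k e u v he hu hv
      have := h4 k (List.getElem?_eq_some_iff.1 he).1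
      rwa [hget _ _ _ _ he, hget _ _ _ _ hu, hget _ _ _ _ hv] at this
    · intro k e he hk
      have := h7 k (List.getElem?_eq_some_iff.1 he).1 hk
      rwa [hget _ _ _ _ he] at this
    · rw [List.pairwise_iff_getElem]
      intro j k hj hk hjk
      have := h8 j k hjk hk
      rwa [hget _ _ _ _ (List.getElem?_eq_getElem hj), hget _ _ _ _ (List.getElem?_eq_getElem hk)]
        at this
  · rintro ⟨h1, h2, h3, h4, h5, h6, h7, h8⟩
    refine ⟨h1, by rwa [List.head?_eq_getElem?], ?_, ?_, h5, h6, ?_, ?_⟩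
    · rw [List.getLast?_eq_getElem?, h1]
      simpa using h3
    · intro k hk
      simp only at hk ⊢
      exact h4 k _ _ _ (hget' _ _ _ hk) (hget' _ _ _ (by omega)) (hget' _ _ _ (by omega))
    · intro k hk hk2
      exact h7 k _ (hget' _ _ _ hk) hk2
    · intro j k hjk hk
      have hj : j < E.length := hjk.trans hk
      have := List.pairwise_iff_getElem.1 h8 j k hj hk hjk
      simp only [hget _ _ _ _ (List.getElem?_eq_getElem hj),
        hget _ _ _ _ (List.getElem?_eq_getElem hk)]
      exact this

namespace TPathSpec

variable {n : ℕ} {T : Triangulation n} {a b : Fin (n + 3)} {V : List (Fin (n + 3))}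
  {E : List (Fin (2 * n + 3))} {e f : Fin (2 * n + 3)} {k : ℕ}

lemma exists_vertex (h : TPathSpec n T a b V E) (hk : k ≤ E.length) : ∃ v, V[k]? = some v :=
  ⟨_, List.getElem?_eq_getElem (by have := h.length; omega)⟩

lemma exists_joins (h : TPathSpec n T a b V E) (he : E[k]? = some e) :
    ∃ u v, V[k]? = some u ∧ V[k + 1]? = some v ∧ Joins n T e u v := by
  have hk := (List.getElem?_eq_some_iff.1 he).1
  obtain ⟨u, hu⟩ := h.exists_vertex hk.le
  obtain ⟨v, hv⟩ := h.exists_vertex (show k + 1 ≤ E.length from hk)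
  exact ⟨u, v, hu, hv, h.joins k e u v he hu hv⟩

lemma eq_cons (h : TPathSpec n T a b V E) : ∃ V' e E', V = a :: V' ∧ E = e :: E' := by
  have h1 := h.first
  have h2 := h.odd
  cases V <;> cases E <;> simp_all

/-- The second edge of a `T`-path does not end at the starting point. -/
lemma not_incident_second (h : TPathSpec n T a b V E) (he : E[1]? = some e) :
    ¬ Incident n T e a := by
  have hlen := (List.getElem?_eq_some_iff.1 he).1
  have h0 : E[0]? = some E[0] := List.getElem?_eq_getElem (by omega)
  obtain ⟨u, v, hu, hv, hf⟩ := h.exists_joins h0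
  obtain ⟨v', w, hv', hw, hj⟩ := h.exists_joins he
  obtain rfl : v = v' := by simp_all
  obtain rfl : u = a := by have := h.first; simp_all
  rw [FirstTriangle.incident_iff hj]
  rintro (rfl | rfl)
  · exact hf.ne rfl
  · have heq := hf.index_eq hj.symm
    have : E[0] = E[1] := by rw [heq]; simpa [hlen] using he.symm
    have := (h.nodup.getElem_inj_iff).1 this
    omega

lemma not_joins_ends (h : TPathSpec n T a b V E) (he : E[k]? = some e) (hk : k % 2 = 1) :
    ¬ Joins n T e a b := by
  intro hj
  have hlen := (List.getElem?_eq_some_iff.1 he).1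
  have h1 : E[1]? = some E[1] := List.getElem?_eq_getElem (by omega)
  have hc : Cross n _ _ _ _ := h.ecross 1 _ h1 (by norm_num)
  have heq : E[1] = e := by
    by_contra hne
    refine T.noncross _ _ hne (hc.congr (Or.inl ⟨rfl, rfl⟩) ?_)
    simp only [Joins, SamePair] at *
    grind
  exact h.not_incident_second h1 ⟨b, heq ▸ hj⟩

end TPathSpec

namespace FirstTriangle

variable {n : ℕ} {T : Triangulation n} {a b c d : Fin (n + 3)} {i0 i1 i1' : Fin (2 * n + 3)}
  {V : List (Fin (n + 3))} {E : List (Fin (2 * n + 3))} {e : Fin (2 * n + 3)} {k : ℕ}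

lemma ecross_of_path (h : FirstTriangle n T a b c d i0 i1 i1') (hγ : TPathSpec n T c b V E)
    (he : E[k]? = some e) (hk : k % 2 = 1) : ECross n T e a b ∧ ¬ Incident n T e c :=
  h.ecross_iff.1 ⟨hγ.ecross k e he hk, hγ.not_joins_ends he hk⟩

lemma vertex_ne (h : FirstTriangle n T a b c d i0 i1 i1') (hγ : TPathSpec n T c b V E)
    {v : Fin (n + 3)} (hv : V[k + 1]? = some v) : v ≠ a ∧ v ≠ c := by
  have hk := (List.getElem?_eq_some_iff.1 hv).1
  have hlen := hγ.length
  have key : ∀ {e}, ECross n T e a b ∧ ¬ Incident n T e c → Incident n T e v → v ≠ a ∧ v ≠ c := by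
    rintro e ⟨h1, h2⟩ h3
    refine ⟨?_, ?_⟩ <;> rintro rfl
    exacts [h.not_incident_a h1 h3, h2 h3]
  rcases Nat.mod_two_eq_zero_or_one k with h2 | h2
  · rcases (show k + 1 = E.length ∨ k + 1 < E.length by omega) with hkl | hkl
    · have := hγ.last
      rw [← hkl, hv, Option.some.injEq] at this
      subst this
      exact ⟨h.ne.symm, h.c_ne_b.symm⟩
    · have he := List.getElem?_eq_getElem hkl
      obtain ⟨u, w, hu, hw, hj⟩ := hγ.exists_joins he
      obtain rfl : v = u := by simp_all
      exact key (h.ecross_of_path hγ he (by omega)) ⟨_, hj⟩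
  · have he := List.getElem?_eq_getElem (show k < E.length by omega)
    obtain ⟨u, w, hu, hw, hj⟩ := hγ.exists_joins he
    obtain rfl : v = w := by simp_all
    exact key (h.ecross_of_path hγ he h2) ⟨_, hj.symm⟩

lemma not_incident_of_mem_tail (h : FirstTriangle n T a b c d i0 i1 i1') {f : Fin (2 * n + 3)}
    (hγ : TPathSpec n T c b V (f :: E)) (he : e ∈ E) :
    ¬ Incident n T e a ∧ ¬ Incident n T e c := by
  obtain ⟨k, hk, rfl⟩ := List.getElem_of_mem he
  obtain ⟨u, v, hu, hv, hj⟩ := hγ.exists_joins (k := k + 1) (e := E[k]) (by simp [hk])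
  have hu' := h.vertex_ne hγ hu
  have hv' := h.vertex_ne hγ hv
  rw [incident_iff hj, incident_iff hj]
  grind

lemma pairwise_before_ab (h : FirstTriangle n T a b c d i0 i1 i1')
    (hE : ∀ e ∈ E, ¬ Incident n T e c) (hn : E.Nodup) (hb : E.Pairwise (Before n T c b)) :
    E.Pairwise (Before n T a b) :=
  (hb.and hn).imp_of_mem fun hi hj hij => h.before_ab hij.2 (hE _ hi) (hE _ hj) hij.1

lemma pairwise_before_cb (h : FirstTriangle n T a b c d i0 i1 i1')
    (hn : E.Nodup) (hb : E.Pairwise (Before n T a b)) : E.Pairwise (Before n T c b) :=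
  (hb.and hn).imp fun hij => h.before_cb hij.2 hij.1

lemma incident_i0 (h : FirstTriangle n T a b c d i0 i1 i1') : Incident n T i0 c := ⟨d, h.joins_cd⟩

lemma incident_i1 (h : FirstTriangle n T a b c d i0 i1 i1') : Incident n T i1 a := ⟨d, h.joins_ad⟩

/-- Replacing the first edge `T_{i_0}` of a path from `c` by `T_{i_1}`. -/
lemma replace_first (h : FirstTriangle n T a b c d i0 i1 i1')
    (hγ : TPathSpec n T c b (c :: V) (i0 :: E)) : TPathSpec n T a b (a :: V) (i1 :: E) := by
  have htail : ∀ e ∈ E, ¬ Incident n T e a ∧ ¬ Incident n T e c :=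
    fun e he => h.not_incident_of_mem_tail hγ he
  have hnd := List.nodup_cons.1 hγ.nodup
  refine ⟨by simpa using hγ.length, rfl, by simpa using hγ.last, ?_, ?_,
    by simpa using hγ.odd, ?_, ?_⟩
  · rintro (_ | k) e u v he hu hv
    · have := hγ.joins 0 i0 c v rfl rfl hv
      obtain rfl := h.joins_cd.right_eq this
      simp only [List.getElem?_cons_zero, Option.some.injEq] at he hu
      exact he ▸ hu ▸ h.joins_ad
    · exact hγ.joins (k + 1) e u v he hu hv
  · exact List.nodup_cons.2 ⟨fun hm => (htail _ hm).1 h.incident_i1, hnd.2⟩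
  · rintro (_ | k) e he hk
    · simp at hk
    · exact (h.ecross_of_path hγ he hk).1
  · exact List.pairwise_cons.2 ⟨fun e _ => before_of_not_ecross_left h.not_ecross_i1,
      h.pairwise_before_ab (fun e he => (htail e he).2) hnd.2 (List.pairwise_cons.1 hγ.before).2⟩

/-- Prepending `T_{i_1}, T_{i_0}` to a path from `c`. -/
lemma prepend (h : FirstTriangle n T a b c d i0 i1 i1')
    (hγ : TPathSpec n T c b (c :: V) (e :: E)) (he0 : e ≠ i0) :
    TPathSpec n T a b (a :: d :: c :: V) (i1 :: i0 :: e :: E) := by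
  have htail : ∀ e ∈ E, ¬ Incident n T e a ∧ ¬ Incident n T e c :=
    fun e he => h.not_incident_of_mem_tail hγ he
  have hnd := List.nodup_cons.1 hγ.nodup
  have hi01 : i1 ≠ i0 := by rintro rfl; exact h.not_ecross_i1 h.ecross
  have hec : Incident n T e c := by
    obtain ⟨u, v, hu, hv, hj⟩ := hγ.exists_joins (k := 0) (e := e) rfl
    simp only [List.getElem?_cons_zero, Option.some.injEq] at hu
    exact ⟨v, hu ▸ hj⟩
  have hi1e : i1 ≠ e := by
    rintro rfl
    rw [incident_iff h.joins_ad] at hec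
    rcases hec with hec | hec
    · exact h.joins_ac.ne hec.symm
    · exact h.joins_cd.ne hec
  have hi0E : i0 ∉ e :: E := by
    rw [List.mem_cons, not_or]
    exact ⟨he0.symm, fun hm => (htail _ hm).2 h.incident_i0⟩
  have hi1E : i1 ∉ i0 :: e :: E := by
    rw [List.mem_cons, List.mem_cons, not_or, not_or]
    exact ⟨hi01, hi1e, fun hm => (htail _ hm).1 h.incident_i1⟩
  refine ⟨by simpa using hγ.length, rfl, by simpa using hγ.last, ?_, ?_, ?_, ?_, ?_⟩
  · rintro (_ | _ | k) f u v he hu hv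
    · simp only [List.getElem?_cons_zero, List.getElem?_cons_succ, Option.some.injEq] at he hu hv
      exact he ▸ hu ▸ hv ▸ h.joins_ad
    · simp only [List.getElem?_cons_zero, List.getElem?_cons_succ, Option.some.injEq] at he hu hv
      exact he ▸ hu ▸ hv ▸ h.joins_cd.symm
    · exact hγ.joins k f u v he hu hv
  · exact List.nodup_cons.2 ⟨hi1E, List.nodup_cons.2 ⟨hi0E, hγ.nodup⟩⟩
  · have := hγ.odd
    rw [Nat.odd_iff] at this ⊢
    simp only [List.length_cons] at this ⊢
    omega
  · rintro (_ | _ | k) f he hk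
    · simp at hk
    · simp only [List.getElem?_cons_zero, List.getElem?_cons_succ, Option.some.injEq] at he
      exact he ▸ h.ecross
    · exact (h.ecross_of_path hγ he (by omega)).1
  · refine List.pairwise_cons.2 ⟨fun f _ => before_of_not_ecross_left h.not_ecross_i1,
      List.pairwise_cons.2 ⟨fun f hf => h.before_of_ne fun hf0 => hi0E (hf0 ▸ hf),
        List.pairwise_cons.2 ⟨fun f hf => ?_, h.pairwise_before_ab (fun e he => (htail e he).2)
          hnd.2 (List.pairwise_cons.1 hγ.before).2⟩⟩⟩
    by_cases hce : ECross n T e a b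
    swap; · exact before_of_not_ecross_left hce
    by_cases hcf : ECross n T f a b
    swap; · exact before_of_not_ecross_right hcf
    exact h.before_of_incident hce hcf hec (htail f hf).2

lemma not_incident_of_cons (h : FirstTriangle n T a b c d i0 i1 i1')
    (hE : (e :: E).Pairwise (Before n T a b)) (he : ECross n T e a b) (hec : ¬ Incident n T e c) :
    ∀ f ∈ e :: E, ECross n T f a b → ¬ Incident n T f c := by
  intro f hf hcf
  rcases List.mem_cons.1 hf with rfl | hf
  · exact hec
  · exact h.not_incident_of_before he hcf hec ((List.pairwise_cons.1 hE).1 f hf)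

/-- Replacing the first edge `T_{i_1}` of a path from `a` by `T_{i_0}`. -/
lemma replace_first_symm (h : FirstTriangle n T a b c d i0 i1 i1')
    (hα : TPathSpec n T a b (a :: V) (i1 :: E)) (hE : E[0]? ≠ some i0) :
    TPathSpec n T c b (c :: V) (i0 :: E) := by
  have hnd := List.nodup_cons.1 hα.nodup
  have hbf := (List.pairwise_cons.1 hα.before).2
  have htail : ∀ e ∈ E, ECross n T e a b → ¬ Incident n T e c := by
    rcases E with _ | ⟨e, E⟩
    · simp
    have hce := hα.ecross 1 e rfl rfl
    refine h.not_incident_of_cons hbf hce ?_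
    obtain ⟨u, v, hu, hv, hj⟩ := hα.exists_joins (k := 1) (e := e) rfl
    have hj' := hα.joins 0 i1 a u rfl rfl hu
    obtain rfl := h.joins_ad.right_eq hj'
    rw [incident_iff hj]
    rintro (rfl | rfl)
    · exact h.joins_cd.ne rfl
    · exact hE (by rw [hj.symm.index_eq h.joins_cd]; rfl)
  refine ⟨by simpa using hα.length, rfl, by simpa using hα.last, ?_, ?_,
    by simpa using hα.odd, ?_, ?_⟩
  · rintro (_ | k) e u v he hu hv
    · have := hα.joins 0 i1 a v rfl rfl hv
      obtain rfl := h.joins_ad.right_eq this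
      simp only [List.getElem?_cons_zero, Option.some.injEq] at he hu
      exact he ▸ hu ▸ h.joins_cd
    · exact hα.joins (k + 1) e u v he hu hv
  · exact List.nodup_cons.2 ⟨fun hm => htail _ hm h.ecross h.incident_i0, hnd.2⟩
  · rintro (_ | k) e he hk
    · simp at hk
    · have hc := hα.ecross (k + 1) e he hk
      rw [List.getElem?_cons_succ] at he
      exact (h.ecross_iff.2 ⟨hc, htail e (List.mem_of_getElem? he) hc⟩).1
  · exact List.pairwise_cons.2 ⟨fun e _ => before_of_not_ecross_left h.not_ecross_i0,
      h.pairwise_before_cb hnd.2 hbf⟩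

/-- Removing the first two edges `T_{i_1}, T_{i_0}` of a path from `a`. -/
lemma drop_two (h : FirstTriangle n T a b c d i0 i1 i1')
    (hα : TPathSpec n T a b V (i1 :: i0 :: E)) :
    ∃ V', V = a :: d :: c :: V' ∧ TPathSpec n T c b (c :: V') E := by
  obtain ⟨u0, u1, hu0, hu1, hj⟩ := hα.exists_joins (k := 0) (e := i1) rfl
  obtain ⟨u1', u2, hu1', hu2, hj'⟩ := hα.exists_joins (k := 1) (e := i0) rfl
  obtain rfl : u0 = a := by have := hα.first; simp_all
  obtain rfl : u1 = u1' := by simp_all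
  obtain rfl := h.joins_ad.right_eq hj
  obtain rfl := h.joins_cd.symm.right_eq hj'
  obtain ⟨V', rfl⟩ : ∃ V', V = u0 :: d :: c :: V' := by
    rcases V with _ | ⟨x, _ | ⟨y, _ | ⟨z, V⟩⟩⟩ <;> simp_all
  refine ⟨V', rfl, ?_⟩
  have hnd := (List.nodup_cons.1 (List.nodup_cons.1 hα.nodup).2).2
  have hbf := (List.pairwise_cons.1 (List.pairwise_cons.1 hα.before).2).2
  have hj2 : ∀ k e u v, E[k]? = some e → (c :: V')[k]? = some u → (c :: V')[k + 1]? = some v →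
      Joins n T e u v := fun k e u v he hu hv => hα.joins (k + 2) e u v he hu hv
  have hlen : (c :: V').length = E.length + 1 := by simpa using hα.length
  refine ⟨hlen, rfl, by simpa using hα.last, hj2, hnd, ?_, ?_, h.pairwise_before_cb hnd hbf⟩
  · have := hα.odd
    rw [Nat.odd_iff] at this ⊢
    simp only [List.length_cons] at this
    omega
  · intro k e he hk
    obtain ⟨f, g, E, rfl⟩ : ∃ f g E', E = f :: g :: E' := by
      have := (List.getElem?_eq_some_iff.1 he).1
      rcases E with _ | ⟨x, _ | ⟨y, E⟩⟩ <;> simp_all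
    obtain ⟨x, y, V', rfl⟩ : ∃ x y V'', V' = x :: y :: V'' := by
      rcases V' with _ | ⟨x, _ | ⟨y, V'⟩⟩ <;> simp_all
    have hf := hj2 0 f c x rfl rfl rfl
    have hg := hj2 1 g x y rfl rfl rfl
    have hgc : ¬ Incident n T g c := by
      rw [incident_iff hg]
      rintro (rfl | rfl)
      · exact hf.ne rfl
      · have := hf.index_eq hg.symm
        simp_all
    have hcg := hα.ecross 3 g rfl rfl
    have hce := hα.ecross (k + 2) e he (by omega)
    refine (h.ecross_iff.2 ⟨hce, ?_⟩).1
    refine h.not_incident_of_cons (List.pairwise_cons.1 hbf).2 hcg hgc e ?_ hce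
    obtain ⟨k, rfl⟩ : ∃ k', k = k' + 1 := ⟨k - 1, by omega⟩
    rw [List.getElem?_cons_succ] at he
    exact List.mem_of_getElem? he

/-- The correspondence from paths starting at `c` to paths starting at `a` with `T_{i_1}`. -/
def lift (n : ℕ) (a d : Fin (n + 3)) (i0 i1 : Fin (2 * n + 3)) (p : PathData n) : PathData n :=
  if p.2[0]? = some i0 then (a :: p.1.tail, i1 :: p.2.tail) else (a :: d :: p.1, i1 :: i0 :: p.2)

/-- The inverse of `lift`. -/
def unlift (n : ℕ) (c : Fin (n + 3)) (i0 : Fin (2 * n + 3)) (p : PathData n) : PathData n :=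
  if p.2[1]? = some i0 then (p.1.drop 2, p.2.drop 2) else (c :: p.1.tail, i0 :: p.2.tail)

lemma bijOn_lift (h : FirstTriangle n T a b c d i0 i1 i1') :
    Set.BijOn (lift n a d i0 i1) (TPaths n T c b) (TPathsFirst n T a b i1) := by
  refine Set.InvOn.bijOn (f' := unlift n c i0) ⟨?_, ?_⟩ ?_ ?_
  · rintro ⟨V, E⟩ hγ
    have hγ' := isTPath_iff.1 hγ
    obtain ⟨V, e, E, rfl, rfl⟩ := hγ'.eq_cons
    by_cases he : e = i0
    · subst he
      have hi0 : E[0]? ≠ some e := fun hE =>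
        (List.nodup_cons.1 hγ'.nodup).1 (List.mem_of_getElem? hE)
      simp [lift, unlift, hi0]
    · simp [lift, unlift, he]
  · rintro ⟨V, E⟩ ⟨hα, hE⟩
    have hα' := isTPath_iff.1 hα
    obtain ⟨V, e, E, rfl, rfl⟩ := hα'.eq_cons
    obtain rfl : e = i1 := by simpa using hE
    by_cases he : E[0]? = some i0
    · obtain ⟨E, rfl⟩ : ∃ E', E = i0 :: E' := by cases E <;> simp_all
      obtain ⟨V', hV, hγ⟩ := h.drop_two hα'
      obtain rfl := (List.cons.inj hV).2
      have hi0 : E[0]? ≠ some i0 := fun hE =>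
        (List.nodup_cons.1 (List.nodup_cons.1 hα'.nodup).2).1 (List.mem_of_getElem? hE)
      simp [lift, unlift, hi0]
    · simp [lift, unlift, he]
  · rintro ⟨V, E⟩ hγ
    have hγ' := isTPath_iff.1 hγ
    obtain ⟨V, e, E, rfl, rfl⟩ := hγ'.eq_cons
    by_cases he : e = i0
    · subst he
      simpa [lift, TPathsFirst, TPaths] using isTPath_iff.2 (h.replace_first hγ')
    · simpa [lift, he, TPathsFirst, TPaths] using isTPath_iff.2 (h.prepend hγ' he)
  · rintro ⟨V, E⟩ ⟨hα, hE⟩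
    have hα' := isTPath_iff.1 hα
    obtain ⟨V, e, E, rfl, rfl⟩ := hα'.eq_cons
    obtain rfl : e = i1 := by simpa using hE
    by_cases he : E[0]? = some i0
    · obtain ⟨E, rfl⟩ : ∃ E', E = i0 :: E' := by cases E <;> simp_all
      obtain ⟨V', hV, hγ⟩ := h.drop_two hα'
      obtain rfl := (List.cons.inj hV).2
      simpa [unlift, TPaths] using isTPath_iff.2 hγ
    · simpa [unlift, he, TPaths] using isTPath_iff.2 (h.replace_first_symm hα' he)

lemma pathX_lift (h : FirstTriangle n T a b c d i0 i1 i1') (p : PathData n)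
    (hp : p ∈ TPaths n T c b) :
    X n i1 / X n i0 * pathX n p.2 = pathX n (lift n a d i0 i1 p).2 := by
  have hX := X_ne_zero n i0
  obtain ⟨V, E⟩ := p
  obtain ⟨V, e, E, rfl, rfl⟩ := (isTPath_iff.1 hp).eq_cons
  by_cases he : e = i0
  · subst he
    simp only [lift, List.getElem?_cons_zero, if_true, List.tail_cons, pathX_cons]
    field_simp
  · simp only [lift, List.getElem?_cons_zero, Option.some.injEq, he, if_false,
      pathX_cons n i1, pathX_cons n i0, mul_inv, inv_inv]
    ring

lemma sum_eq (h : FirstTriangle n T a b c d i0 i1 i1') :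
    (∑ᶠ γ ∈ TPaths n T c b, pathX n γ.2) * (X n i1 / X n i0) =
      ∑ᶠ α ∈ TPathsFirst n T a b i1, pathX n α.2 := by
  rw [← finsum_mem_eq_of_bijOn _ h.bijOn_lift h.pathX_lift, mul_comm, ← smul_eq_mul, smul_finsum]
  refine finsum_congr fun p => ?_
  rw [smul_finsum]
  rfl

end FirstTriangle

/-- Lemma 2.7. -/
theorem sum_TPaths_first_edge
    (n : ℕ) (hn : 1 ≤ n) (T : Triangulation n) (a b c d : Fin (n + 3))
    (i0 i1 i1' : Fin (2 * n + 3))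
    (hab : a ≠ b) (hnadj : ¬ Adj n a b)
    (hM : ¬ ∃ i : Fin (2 * n + 3), Joins n T i a b)
    (hi0d : i0.val < n) (hi0M : ECross n T i0 a b)
    (hclosest : ∀ j : Fin (2 * n + 3), j.val < n → ECross n T j a b → j ≠ i0 →
      ∀ x ∈ crossPts n T i0 a b, ∀ y ∈ crossPts n T j a b,
        dist (vtx n a) x < dist (vtx n a) y)
    (hcd : Joins n T i0 c d)
    (hi1' : Joins n T i1' a c) (hi1 : Joins n T i1 a d)
    :
    (∑ᶠ γ ∈ TPaths n T c b, pathX n γ.2) * (X n i1 / X n i0) =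
        (∑ᶠ α ∈ TPathsFirst n T a b i1, pathX n α.2) ∧
    (∑ᶠ γ ∈ TPaths n T d b, pathX n γ.2) * (X n i1' / X n i0) =
        (∑ᶠ α ∈ TPathsFirst n T a b i1', pathX n α.2) := by
  have h : FirstTriangle n T a b c d i0 i1 i1' :=
    ⟨hab, fun i hi => hM ⟨i, hi⟩, hi0M, hcd, hi1', hi1⟩
  exact ⟨h.sum_eq, h.symm.sum_eq⟩
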